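/- arXiv:2011.09904 — 4 statements merged into one kernel-verified Lean document; each statement's English description precedes it below -/
import Mathlib

section
/- Let K ⊆ L be a field extension and put T = K + X·L[X]. Then T is a Noetherian ring if and only if the degree [L : K] is finite (i.e., L is a finite-dimensional K-vector space). -/
/-- The polynomial composite `K + X·L[X]`: the subring of `L[X]` consisting of
all polynomials whose constant term lies in (the image of) `K`. -/
def polynomialComposite (K L : Type*) [Field K] [Field L] [Algebra K L] :
    Subring (Polynomial L) where
  carrier := {p | p.coeff 0 ∈ (algebraMap K L).range}
  mul_mem' := by
    intro a b ha hb
    simp only [Set.mem_setOf_eq, Polynomial.mul_coeff_zero] at *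
    exact mul_mem ha hb
  one_mem' := by simp
  add_mem' := by
    intro a b ha hb
    simp only [Set.mem_setOf_eq, Polynomial.coeff_add] at *
    exact add_mem ha hb
  zero_mem' := by simp
  neg_mem' := by
    intro a ha
    simp only [Set.mem_setOf_eq, Polynomial.coeff_neg] at *
    exact neg_mem ha

open Polynomial in
/-- If `K + X·L[X]` is Noetherian, the linear coefficients of finitely many generators of the ideal
of polynomials without constant term span `L` over `K`. -/
theorem finiteDimensional_of_isNoetherianRing_polynomialComposite
    (K L : Type*) [Field K] [Field L] [Algebra K L]
    [IsNoetherianRing (polynomialComposite K L)] : FiniteDimensional K L := by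
  classical
  let T := polynomialComposite K L
  obtain ⟨s, hs⟩ := IsNoetherian.noetherian
    (RingHom.ker ((constantCoeff (R := L)).comp T.subtype))
  refine ⟨⟨s.image fun p : T => (p : L[X]).coeff 1, eq_top_iff.mpr fun l _ => ?_⟩⟩
  have key : ∀ p ∈ Submodule.span T (s : Set T), (p : L[X]).coeff 0 = 0 ∧
      (p : L[X]).coeff 1 ∈ Submodule.span K ((fun p : T => (p : L[X]).coeff 1) '' (s : Set T)) := by
    intro p hp
    induction hp using Submodule.span_induction with
    | mem p hp =>
      have hp0 : p ∈ RingHom.ker ((constantCoeff (R := L)).comp T.subtype) :=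
        hs ▸ Submodule.subset_span hp
      exact ⟨by simpa [RingHom.mem_ker] using hp0, Submodule.subset_span ⟨p, hp, rfl⟩⟩
    | zero => simp
    | add p q _ _ hp hq =>
      exact ⟨by simp [hp.1, hq.1], by simpa using add_mem hp.2 hq.2⟩
    | smul t p _ hp =>
      obtain ⟨k, hk⟩ := t.2
      refine ⟨by simp [mul_coeff_zero, hp.1], ?_⟩
      have h : ((t • p : T) : L[X]).coeff 1 = k • (p : L[X]).coeff 1 := by
        simp [mul_coeff_one, hp.1, Algebra.smul_def, hk]
      rw [h]
      exact Submodule.smul_mem _ k hp.2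
  have hX : (C l * X : L[X]) ∈ T := ⟨0, by simp⟩
  have hmem : (⟨C l * X, hX⟩ : T) ∈ Submodule.span T (s : Set T) := by
    rw [hs]
    simp [RingHom.mem_ker]
  simpa using (key _ hmem).2

open Polynomial in
attribute [local instance] Polynomial.algebra in
/-- If `L` is finite over `K`, then `K + X·L[X]` is a `K[X]`-submodule of the finite
`K[X]`-module `L[X]`. -/
theorem isNoetherianRing_polynomialComposite
    (K L : Type*) [Field K] [Field L] [Algebra K L] [FiniteDimensional K L] :
    IsNoetherianRing (polynomialComposite K L) := by
  let T := polynomialComposite K L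
  let S : Subalgebra K[X] L[X] :=
    { T with algebraMap_mem' := fun p => ⟨p.coeff 0, by simp [Polynomial.algebraMap_def]⟩ }
  have : Module.Finite K[X] L[X] :=
    Module.Finite.equiv (Algebra.IsPushout.equiv K K[X] L L[X]).toLinearEquiv
  have : IsNoetherian K[X] S := isNoetherian_of_injective S.val.toLinearMap Subtype.val_injective
  exact (isNoetherian_of_tower K[X] this : IsNoetherianRing S)

theorem composite_noetherian_iff_finiteDimensional
    (K L : Type*) [Field K] [Field L] [Algebra K L] :
    IsNoetherianRing (polynomialComposite K L) ↔ FiniteDimensional K L := by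
  exact ⟨fun _ => finiteDimensional_of_isNoetherianRing_polynomialComposite K L,
    fun _ => isNoetherianRing_polynomialComposite K L⟩
end

section
/- Let K ⊆ L be a field extension such that L^{G(L|K)} = K, and put T = K + X·L[X]. If T is a Noetherian ring, then K ⊆ L is an algebraic extension. -/
open Polynomial in
/-- The ideal of `K + X·L[X]` attached to a `K`-subspace `V` of `L`: the polynomials with zero
constant term and linear coefficient in `V`. -/
def polynomialComposite.idealOfSubmodule {K L : Type*} [Field K] [Field L] [Algebra K L]
    (V : Submodule K L) : Ideal (polynomialComposite K L) where
  carrier := {p | (p : L[X]).coeff 0 = 0 ∧ (p : L[X]).coeff 1 ∈ V}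
  add_mem' := by
    rintro a b ⟨ha, ha'⟩ ⟨hb, hb'⟩
    exact ⟨by simp [ha, hb], by simpa using V.add_mem ha' hb'⟩
  zero_mem' := by simp
  smul_mem' := by
    rintro ⟨c, k, hk⟩ p ⟨hp, hp'⟩
    refine ⟨by simp [mul_coeff_zero, hp], ?_⟩
    simpa [mul_coeff_one, hp, ← hk, Algebra.smul_def] using V.smul_mem k hp'

open Polynomial in
theorem polynomialComposite.idealOfSubmodule_strictMono (K L : Type*) [Field K] [Field L]
    [Algebra K L] :
    StrictMono (idealOfSubmodule : Submodule K L → Ideal (polynomialComposite K L)) := by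
  refine Monotone.strictMono_of_injective (fun V W h p hp => ⟨hp.1, h hp.2⟩) fun V W h => ?_
  ext v
  have hv : (C v * X : L[X]) ∈ polynomialComposite K L :=
    ⟨0, by simp⟩
  have mem_iff (U : Submodule K L) : ⟨C v * X, hv⟩ ∈ idealOfSubmodule U ↔ v ∈ U := by
    change (C v * X : L[X]).coeff 0 = 0 ∧ (C v * X : L[X]).coeff 1 ∈ U ↔ v ∈ U
    simp
  rw [← mem_iff V, h, mem_iff W]

/-- If `K + X·L[X]` is Noetherian, then `L` is finite over `K`. -/
theorem polynomialComposite.finite_of_isNoetherianRing (K L : Type*) [Field K] [Field L]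
    [Algebra K L] (hT : IsNoetherianRing (polynomialComposite K L)) : Module.Finite K L := by
  have : WellFoundedGT (Ideal (polynomialComposite K L)) := isNoetherian_iff'.mp hT
  have : IsNoetherian K L :=
    isNoetherian_iff'.mpr (idealOfSubmodule_strictMono K L).wellFoundedGT
  infer_instance

theorem algebraic_of_composite_noetherian
    (K L : Type*) [Field K] [Field L] [Algebra K L]
    (hfix : ∀ x : L, (∀ σ : L ≃ₐ[K] L, σ x = x) → x ∈ (algebraMap K L).range)
    (hT : IsNoetherianRing (polynomialComposite K L)) :
    Algebra.IsAlgebraic K L := by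
  have := polynomialComposite.finite_of_isNoetherianRing K L hT
  infer_instance
end

section
/- Let K ⊆ L ⊆ M be a tower of field extensions with K a perfect field. If the rings K + X·L[X] and L + X·M[X] are both Noetherian, then K ⊆ M is a separable field extension and, moreover, K + X·M[X] is a Noetherian ring. -/
open Polynomial in
/-- If `K + X·L[X]` is Noetherian, then `L` is finite over `K`. -/
theorem finite_of_isNoetherianRing_polynomialComposite
    (K L : Type*) [Field K] [Field L] [Algebra K L]
    (h : IsNoetherianRing (polynomialComposite K L)) : Module.Finite K L := by
  let φ : polynomialComposite K L →+* L :=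
    (constantCoeff : L[X] →+* L).comp (polynomialComposite K L).subtype
  obtain ⟨S, hS⟩ := (isNoetherianRing_iff_ideal_fg _).1 h (RingHom.ker φ)
  let c : polynomialComposite K L → L := fun x => (x : L[X]).coeff 1
  have key : ∀ x ∈ Ideal.span (S : Set (polynomialComposite K L)),
      c x ∈ Submodule.span K (c '' S) := by
    intro x hx
    induction hx using Submodule.span_induction with
    | mem x hx => exact Submodule.subset_span ⟨x, hx, rfl⟩
    | zero => simp [c]
    | add x y _ _ hx hy => simpa [c] using add_mem hx hy
    | smul a x hxS hx =>
      have h0 : (x : L[X]).coeff 0 = 0 := by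
        have : x ∈ RingHom.ker φ := hS ▸ hxS
        simpa [φ, RingHom.mem_ker] using this
      obtain ⟨k, hk⟩ := a.2
      have : c (a • x) = k • c x := by
        simp [c, mul_coeff_one, h0, Algebra.smul_def, hk]
      rw [this]
      exact Submodule.smul_mem _ _ hx
  refine ⟨Submodule.fg_def.2 ⟨c '' S, S.finite_toSet.image c, ?_⟩⟩
  refine eq_top_iff.2 fun (l : L) _ => ?_
  let y : polynomialComposite K L := ⟨C l * X, by
    change (C l * X).coeff 0 ∈ (algebraMap K L).range
    simp⟩
  have hy : y ∈ RingHom.ker φ := by simp [φ, y, RingHom.mem_ker]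
  simpa [c, y] using key y (hS ▸ hy)

open Polynomial in
/-- If `L` is finite over `K`, then `K + X·L[X]` is Noetherian. -/
theorem isNoetherianRing_polynomialComposite_of_finite
    (K L : Type*) [Field K] [Field L] [Algebra K L] [Module.Finite K L] :
    IsNoetherianRing (polynomialComposite K L) := by
  let _ : Algebra K[X] L[X] := Polynomial.algebra K L
  have : Module.Finite K[X] L[X] :=
    Module.Finite.equiv (Algebra.IsPushout.equiv K K[X] L L[X]).toLinearEquiv
  let A : Subalgebra K[X] L[X] :=
    { (polynomialComposite K L).toSubsemiring with
      algebraMap_mem' := fun p => by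
        change (algebraMap K[X] L[X] p).coeff 0 ∈ (algebraMap K L).range
        simp [Polynomial.algebraMap_def] }
  have : IsNoetherian K[X] A := inferInstanceAs (IsNoetherian K[X] (Subalgebra.toSubmodule A))
  exact (isNoetherian_of_tower K[X] this : IsNoetherianRing A)

theorem separable_and_noetherian_of_tower
    (K L M : Type*) [Field K] [Field L] [Field M]
    [Algebra K L] [Algebra L M] [Algebra K M] [IsScalarTower K L M]
    [PerfectField K]
    (hKL : IsNoetherianRing (polynomialComposite K L))
    (hLM : IsNoetherianRing (polynomialComposite L M)) :
    Algebra.IsSeparable K M ∧ IsNoetherianRing (polynomialComposite K M) := by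
  have := finite_of_isNoetherianRing_polynomialComposite K L hKL
  have := finite_of_isNoetherianRing_polynomialComposite L M hLM
  have : Module.Finite K M := Module.Finite.trans L M
  exact ⟨inferInstance, isNoetherianRing_polynomialComposite_of_finite K M⟩
end

section
/- Let K ⊆ L ⊆ M be a tower of field extensions such that M^{G(M|K)} = K. If the ring K + X·M[X] is Noetherian, then L ⊆ M is a normal field extension and, moreover, L + X·M[X] is a Noetherian ring. -/
open Polynomial in
attribute [local instance] Polynomial.algebra in
theorem Polynomial.finite_of_finite (K L : Type*) [CommRing K] [CommRing L] [Algebra K L]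
    [Module.Finite K L] : Module.Finite K[X] L[X] := by
  obtain ⟨s, hs⟩ := Module.Finite.fg_top (R := K) (M := L)
  refine ⟨Submodule.fg_def.mpr ⟨C '' (s : Set L), s.finite_toSet.image _, ?_⟩⟩
  refine (Submodule.eq_top_iff').mpr fun p ↦ ?_
  induction p using Polynomial.induction_on' with
  | add p q hp hq => exact Submodule.add_mem _ hp hq
  | monomial n a =>
    have ha : a ∈ Submodule.span K (s : Set L) := hs ▸ Submodule.mem_top
    have hC : C a ∈ Submodule.span K[X] (C '' (s : Set L)) := by
      induction ha using Submodule.span_induction with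
      | mem x hx => exact Submodule.subset_span ⟨x, hx, rfl⟩
      | zero => simp
      | add x y _ _ hx hy => simpa using Submodule.add_mem _ hx hy
      | smul k x _ hx =>
        have := Submodule.smul_mem _ (C k : K[X]) hx
        simpa [Algebra.smul_def, RingHom.algebraMap_toAlgebra] using this
    have := Submodule.smul_mem _ (X ^ n : K[X]) hC
    simpa [Algebra.smul_def, RingHom.algebraMap_toAlgebra, X_pow_mul, C_mul_X_pow_eq_monomial]
      using this

namespace polynomialComposite

open Polynomial

theorem mem_iff {K L : Type*} [Field K] [Field L] [Algebra K L] {p : L[X]} :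
    p ∈ polynomialComposite K L ↔ p.coeff 0 ∈ (algebraMap K L).range :=
  Iff.rfl

/-- If `K + X·L[X]` is Noetherian, then `L` is finite over `K`: the linear coefficients of
generators of the ideal `X·L[X]` span `L`. -/
theorem finite_of_isNoetherianRing_s10 (K L : Type*) [Field K] [Field L] [Algebra K L]
    [IsNoetherianRing (polynomialComposite K L)] : Module.Finite K L := by
  let I : Ideal (polynomialComposite K L) :=
    RingHom.ker ((constantCoeff : L[X] →+* L).comp (polynomialComposite K L).subtype)
  obtain ⟨s, hs⟩ := (isNoetherianRing_iff_ideal_fg _).mp ‹_› I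
  have hI (p : polynomialComposite K L) : p ∈ I ↔ (p : L[X]).coeff 0 = 0 := by
    simp [I, RingHom.mem_ker]
  let V : Submodule K L :=
    Submodule.span K ((fun p : polynomialComposite K L ↦ (p : L[X]).coeff 1) '' s)
  have hV (p : polynomialComposite K L) (hp : p ∈ I) : (p : L[X]).coeff 1 ∈ V := by
    rw [← hs] at hp
    induction hp using Submodule.span_induction with
    | mem p hp => exact Submodule.subset_span ⟨p, hp, rfl⟩
    | zero => simp
    | add p q _ _ hp hq => simpa using V.add_mem hp hq
    | smul r p hp h =>
      obtain ⟨k, hk⟩ := mem_iff.mp r.2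
      have h0 : (p : L[X]).coeff 0 = 0 := (hI p).mp (hs ▸ hp)
      rw [smul_eq_mul, Subring.coe_mul, mul_coeff_one, h0, mul_zero, add_zero, ← hk,
        ← Algebra.smul_def]
      exact V.smul_mem k h
  refine ⟨Submodule.fg_def.mpr ⟨_, s.finite_toSet.image
    fun p : polynomialComposite K L ↦ (p : L[X]).coeff 1, ?_⟩⟩
  refine eq_top_iff.mpr fun m _ ↦ ?_
  have hm : C m * X ∈ polynomialComposite K L := mem_iff.mpr (by simp)
  simpa using hV ⟨C m * X, hm⟩ ((hI _).mpr (by simp))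

attribute [local instance] Polynomial.algebra in
/-- If `L` is finite over `K`, then `K + X·L[X]` is a `K[X]`-submodule of the finite module `L[X]`,
hence a Noetherian ring. -/
theorem isNoetherianRing_of_finite (K L : Type*) [Field K] [Field L] [Algebra K L]
    [Module.Finite K L] : IsNoetherianRing (polynomialComposite K L) := by
  have := Polynomial.finite_of_finite K L
  let f : K[X] →+* polynomialComposite K L :=
    (mapRingHom (algebraMap K L)).codRestrict _ fun p ↦ mem_iff.mpr ⟨p.coeff 0, by simp⟩
  let : Algebra K[X] (polynomialComposite K L) := f.toAlgebra
  let g : polynomialComposite K L →ₗ[K[X]] L[X] :=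
    { toFun := Subtype.val
      map_add' := fun _ _ ↦ rfl
      map_smul' := fun r p ↦ by
        rw [Algebra.smul_def, Algebra.smul_def]
        rfl }
  have : IsNoetherian K[X] (polynomialComposite K L) :=
    isNoetherian_of_injective g Subtype.val_injective
  exact isNoetherian_of_tower K[X] this

end polynomialComposite

theorem normal_and_noetherian_of_tower_of_fixedField
    (K L M : Type*) [Field K] [Field L] [Field M]
    [Algebra K L] [Algebra L M] [Algebra K M] [IsScalarTower K L M]
    (hfix : ∀ x : M, (∀ σ : M ≃ₐ[K] M, σ x = x) → x ∈ (algebraMap K M).range)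
    (hKM : IsNoetherianRing (polynomialComposite K M)) :
    Normal L M ∧ IsNoetherianRing (polynomialComposite L M) := by
  have := polynomialComposite.finite_of_isNoetherianRing_s10 K M
  have : IsGalois K M := IsGalois.of_fixedField_eq_bot K M <| eq_bot_iff.mpr fun x hx ↦
    IntermediateField.mem_bot.mpr <| hfix x fun σ ↦ hx ⟨σ, trivial⟩
  have : Module.Finite L M := Module.Finite.of_restrictScalars_finite K L M
  exact ⟨Normal.tower_top_of_normal K L M, polynomialComposite.isNoetherianRing_of_finite L M⟩
end
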